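/- arXiv:2405.08640 — 5 statements merged into one kernel-verified Lean document; each statement's English description precedes it below -/
import Mathlib

section
/- Let K ≥ 1 and let κ : [0,∞) → M_K(ℝ) be a measurable, locally bounded, entrywise nonnegative and entrywise integrable matrix-valued kernel such that the spectral radius of B = ∫₀^∞ κ(s) ds is strictly less than 1. Then: (i) for every k ≥ 1 the iterated convolution κ^{⋆k} is entrywise integrable on [0,∞) with ∫₀^∞ κ^{⋆k}(s) ds = B^k; (ii) the pointwise sum 𝒦(t) = Σ_{k≥1} κ^{⋆k}(t) is finite for almost every t ≥ 0 and defines an entrywise integrable function on [0,∞); and (iii) ∫₀^∞ 𝒦(s) ds = Σ_{k≥1} B^k = (I − B)⁻¹ B, where I − B is invertible. -/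
open MeasureTheory Matrix

noncomputable section

/-- Convolution of matrix-valued kernels on `[0,∞)`:
`(f ⋆ g)(t) = ∫₀ᵗ f (t - s) * g s ds` (matrix product inside the integral). -/
def matConv {K : ℕ} (f g : ℝ → Matrix (Fin K) (Fin K) ℝ) : ℝ → Matrix (Fin K) (Fin K) ℝ :=
  fun t => Matrix.of fun i j => ∫ s in (0:ℝ)..t, (f (t - s) * g s) i j

/-- Iterated convolutions: `iterConv κ 0 = κ` (this is `κ^{⋆1}`), and
`iterConv κ (k+1) = (iterConv κ k) ⋆ κ` (this is `κ^{⋆(k+2)}`). -/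
def iterConv {K : ℕ} (κ : ℝ → Matrix (Fin K) (Fin K) ℝ) : ℕ → ℝ → Matrix (Fin K) (Fin K) ℝ
  | 0 => κ
  | k + 1 => matConv (iterConv κ k) κ

open Set Filter Topology
open scoped ENNReal

section Summability

variable {α E ι : Type*} [MeasurableSpace α] {μ : Measure α} [NormedAddCommGroup E]
  [CompleteSpace E]

/-- A series of integrable functions with summable `L¹` norms converges almost everywhere. -/
theorem ae_summable_of_summable_integral_norm [Countable ι] {F : ι → α → E}
    (hF : ∀ i, Integrable (F i) μ) (hsum : Summable fun i => ∫ a, ‖F i a‖ ∂μ) :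
    ∀ᵐ a ∂μ, Summable fun i => F i a := by
  have h : ∑' i, eLpNorm (F i) 1 μ ≠ ∞ := by
    have (i : ι) : eLpNorm (F i) 1 μ = ENNReal.ofReal (∫ a, ‖F i a‖ ∂μ) := by
      rw [eLpNorm_one_eq_lintegral_enorm, ofReal_integral_norm_eq_lintegral_enorm (hF i)]
    simp_rw [this]
    exact hsum.tsum_ofReal_ne_top
  filter_upwards [summable_norm_of_tsum_eLpNorm_ne_top le_rfl (fun i => (hF i).1) h] with a ha
  exact ha.of_norm

/-- The pointwise sum of a series of integrable functions with summable `L¹` norms is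
integrable. -/
theorem integrable_tsum_of_summable_integral_norm {F : ℕ → α → E}
    (hF : ∀ i, Integrable (F i) μ) (hsum : Summable fun i => ∫ a, ‖F i a‖ ∂μ) :
    Integrable (fun a => ∑' i, F i a) μ := by
  refine ⟨?_, ?_⟩
  · refine aestronglyMeasurable_of_tendsto_ae atTop
      (f := fun n a => ∑ i ∈ Finset.range n, F i a) (fun n => ?_) ?_
    · exact (integrable_finsetSum _ fun i _ => hF i).1
    · filter_upwards [ae_summable_of_summable_integral_norm hF hsum] with a ha
      exact ha.hasSum.tendsto_sum_nat
  · have (i : ℕ) : ∫⁻ a, ‖F i a‖ₑ ∂μ = ENNReal.ofReal (∫ a, ‖F i a‖ ∂μ) :=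
      (ofReal_integral_norm_eq_lintegral_enorm (hF i)).symm
    calc ∫⁻ a, ‖∑' i, F i a‖ₑ ∂μ ≤ ∫⁻ a, ∑' i, ‖F i a‖ₑ ∂μ :=
          lintegral_mono fun a => enorm_tsum_le_tsum_enorm
      _ = ∑' i, ∫⁻ a, ‖F i a‖ₑ ∂μ := lintegral_tsum fun i => (hF i).1.enorm
      _ < ∞ := by
          simp_rw [this]
          exact hsum.tsum_ofReal_ne_top.lt_top

end Summability

section SpectralRadius

/-- In a complex Banach algebra, the powers of an element of spectral radius less than one are
absolutely summable. -/
theorem summable_norm_pow_of_spectralRadius_lt_one {A : Type*} [NormedRing A] [NormedAlgebra ℂ A]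
    [CompleteSpace A] {a : A} (ha : spectralRadius ℂ a < 1) : Summable fun n : ℕ => ‖a ^ n‖ := by
  obtain ⟨r, har, hr⟩ := ENNReal.lt_iff_exists_nnreal_btwn.1 ha
  have hr1 : r < 1 := by exact_mod_cast hr
  have hev := (spectrum.pow_nnnorm_pow_one_div_tendsto_nhds_spectralRadius a).eventually_lt_const har
  refine Summable.of_norm_bounded_eventually_nat (g := fun n => (r : ℝ) ^ n)
    (summable_geometric_of_lt_one r.2 hr1) ?_
  filter_upwards [hev, eventually_gt_atTop 0] with n hn hn0
  have h0 : (0 : ℝ) < n := by exact_mod_cast hn0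
  have h1 : (‖a ^ n‖₊ : ℝ≥0∞) ≤ (r : ℝ≥0∞) ^ n := by
    rw [one_div, ENNReal.rpow_inv_lt_iff h0] at hn
    simpa using hn.le
  rw [norm_norm]
  exact_mod_cast h1

attribute [local instance] Matrix.linftyOpNormedRing Matrix.linftyOpNormedAlgebra in
/-- The powers of a real matrix of spectral radius less than one are summable. -/
theorem Matrix.summable_pow_of_spectralRadius_lt_one {n : Type*} [Fintype n] [DecidableEq n]
    {B : Matrix n n ℝ} (hB : spectralRadius ℂ (B.map (Complex.ofReal ·)) < 1) :
    Summable fun k : ℕ => B ^ k := by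
  have h := (summable_norm_pow_of_spectralRadius_lt_one hB).of_norm
  refine Pi.summable.2 fun i => Pi.summable.2 fun j => ?_
  have hij := Pi.summable.1 (Pi.summable.1 h i) j
  refine Complex.summable_ofReal.1 (hij.congr fun k => ?_)
  exact (congrFun₂ (Matrix.map_pow B Complex.ofRealHom k) i j).symm

end SpectralRadius

section Convolution

variable {f g : ℝ → ℝ}

/-- The integrand of a forward convolution of integrable functions is almost everywhere
integrable. -/
theorem ae_intervalIntegrable_sub_mul (hf : IntegrableOn f (Ioi 0)) (hg : IntegrableOn g (Ioi 0)) :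
    ∀ᵐ t ∂(volume.restrict (Ioi (0 : ℝ))),
      IntervalIntegrable (fun s => f (t - s) * g s) volume 0 t := by
  rw [← integrable_indicator_iff measurableSet_Ioi] at hf hg
  filter_upwards [ae_restrict_of_ae (hg.ae_convolution_exists (ContinuousLinearMap.mul ℝ ℝ) hf),
    ae_restrict_mem measurableSet_Ioi] with t ht ht0
  rw [intervalIntegrable_iff_integrableOn_Ioo_of_le (le_of_lt ht0)]
  refine (ht.integrableOn (s := Ioo 0 t)).congr_fun (fun s hs => ?_) measurableSet_Ioo
  simp [indicator, hs.1, hs.2, mul_comm]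

theorem integrableOn_forward_convolution (hf : IntegrableOn f (Ioi 0))
    (hg : IntegrableOn g (Ioi 0)) :
    IntegrableOn (fun t => ∫ s in (0 : ℝ)..t, f (t - s) * g s) (Ioi 0) := by
  have h := integrable_posConvolution hg hf (ContinuousLinearMap.mul ℝ ℝ)
  rw [posConvolution, integrable_indicator_iff measurableSet_Ioi] at h
  simpa [mul_comm] using h

theorem integral_forward_convolution (hf : IntegrableOn f (Ioi 0)) (hg : IntegrableOn g (Ioi 0)) :
    ∫ t in Ioi (0 : ℝ), ∫ s in (0 : ℝ)..t, f (t - s) * g s =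
      (∫ t in Ioi (0 : ℝ), f t) * ∫ t in Ioi (0 : ℝ), g t := by
  simpa [mul_comm] using integral_posConvolution hg hf (ContinuousLinearMap.mul ℝ ℝ)

variable {K : ℕ} {F G : ℝ → Matrix (Fin K) (Fin K) ℝ}

/-- Almost everywhere, the entries of a convolution of matrix kernels are sums of scalar
convolutions. -/
theorem matConv_apply_ae_eq (hF : ∀ i j, IntegrableOn (fun t => F t i j) (Ioi 0))
    (hG : ∀ i j, IntegrableOn (fun t => G t i j) (Ioi 0)) (i j : Fin K) :
    (fun t => matConv F G t i j) =ᵐ[volume.restrict (Ioi 0)]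
      fun t => ∑ l, ∫ s in (0 : ℝ)..t, F (t - s) i l * G s l j := by
  have h : ∀ᵐ t ∂(volume.restrict (Ioi (0 : ℝ))), ∀ l,
      IntervalIntegrable (fun s => F (t - s) i l * G s l j) volume 0 t :=
    ae_all_iff.2 fun l => ae_intervalIntegrable_sub_mul (hF i l) (hG l j)
  filter_upwards [h] with t ht
  simp only [matConv, Matrix.of_apply, Matrix.mul_apply]
  exact intervalIntegral.integral_finsetSum fun l _ => ht l

theorem integrableOn_matConv (hF : ∀ i j, IntegrableOn (fun t => F t i j) (Ioi 0))
    (hG : ∀ i j, IntegrableOn (fun t => G t i j) (Ioi 0)) (i j : Fin K) :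
    IntegrableOn (fun t => matConv F G t i j) (Ioi 0) :=
  (integrable_finsetSum _ fun l _ =>
    integrableOn_forward_convolution (hF i l) (hG l j)).congr (matConv_apply_ae_eq hF hG i j).symm

/-- The total mass of a convolution of matrix kernels is the product of the total masses. -/
theorem integral_matConv (hF : ∀ i j, IntegrableOn (fun t => F t i j) (Ioi 0))
    (hG : ∀ i j, IntegrableOn (fun t => G t i j) (Ioi 0)) :
    (Matrix.of fun i j => ∫ t in Ioi (0 : ℝ), matConv F G t i j) =
      (Matrix.of fun i j => ∫ t in Ioi (0 : ℝ), F t i j) *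
        Matrix.of fun i j => ∫ t in Ioi (0 : ℝ), G t i j := by
  ext i j
  simp only [Matrix.of_apply, Matrix.mul_apply]
  rw [integral_congr_ae (matConv_apply_ae_eq hF hG i j), integral_finsetSum _ fun l _ =>
    integrableOn_forward_convolution (hF i l) (hG l j)]
  exact Finset.sum_congr rfl fun l _ => integral_forward_convolution (hF i l) (hG l j)

theorem matConv_nonneg (hF : ∀ t, 0 ≤ t → ∀ i j, 0 ≤ F t i j)
    (hG : ∀ t, 0 ≤ t → ∀ i j, 0 ≤ G t i j) (t : ℝ) (ht : 0 ≤ t) (i j : Fin K) :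
    0 ≤ matConv F G t i j :=
  intervalIntegral.integral_nonneg ht fun s hs => by
    rw [Matrix.mul_apply]
    exact Finset.sum_nonneg fun l _ =>
      mul_nonneg (hF _ (sub_nonneg.2 hs.2) i l) (hG s hs.1 l j)

theorem iterConv_nonneg (hF : ∀ t, 0 ≤ t → ∀ i j, 0 ≤ F t i j) (k : ℕ) :
    ∀ t, 0 ≤ t → ∀ i j, 0 ≤ iterConv F k t i j := by
  induction k with
  | zero => exact hF
  | succ k ih => exact matConv_nonneg ih hF

theorem integrableOn_iterConv (hF : ∀ i j, IntegrableOn (fun t => F t i j) (Ioi 0)) (k : ℕ) :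
    ∀ i j, IntegrableOn (fun t => iterConv F k t i j) (Ioi 0) := by
  induction k with
  | zero => exact hF
  | succ k ih => exact integrableOn_matConv ih hF

theorem integral_iterConv (hF : ∀ i j, IntegrableOn (fun t => F t i j) (Ioi 0)) (k : ℕ) :
    (Matrix.of fun i j => ∫ t in Ioi (0 : ℝ), iterConv F k t i j) =
      (Matrix.of fun i j => ∫ t in Ioi (0 : ℝ), F t i j) ^ (k + 1) := by
  induction k with
  | zero => simp [iterConv]
  | succ k ih =>
    rw [pow_succ, ← ih]
    exact integral_matConv (integrableOn_iterConv hF k) hF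

end Convolution

/-- **Integrability and total mass of the resolvent kernel.**
If `κ` is a measurable, locally bounded, entrywise nonnegative and entrywise integrable
matrix-valued kernel whose total mass matrix `B = ∫₀^∞ κ` has spectral radius `< 1`, then:
(i) every iterated convolution `κ^{⋆k}` is entrywise integrable with `∫₀^∞ κ^{⋆k} = B^k`;
(ii) the pointwise sum `𝒦(t) = Σ_{k≥1} κ^{⋆k}(t)` converges for a.e. `t > 0` and is entrywise
integrable; and (iii) `I - B` is invertible and `∫₀^∞ 𝒦 = Σ_{k≥1} B^k = (I - B)⁻¹ B`. -/
theorem resolvent_kernel_integrable_and_total_mass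
    {K : ℕ} (hK : 1 ≤ K)
    (κ : ℝ → Matrix (Fin K) (Fin K) ℝ)
    (hκ_meas : ∀ i j, Measurable fun t => κ t i j)
    (hκ_locbdd : ∀ r : ℝ, 0 ≤ r → ∃ C : ℝ, ∀ t ∈ Set.Icc (0:ℝ) r, ∀ i j, |κ t i j| ≤ C)
    (hκ_nonneg : ∀ t, 0 ≤ t → ∀ i j, 0 ≤ κ t i j)
    (hκ_int : ∀ i j, IntegrableOn (fun t => κ t i j) (Set.Ioi 0))
    (B : Matrix (Fin K) (Fin K) ℝ)
    (hB : B = Matrix.of fun i j => ∫ t in Set.Ioi (0:ℝ), κ t i j)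
    (hρ : spectralRadius ℂ (B.map (Complex.ofReal ·)) < 1) :
    -- (i)
    (∀ k : ℕ, (∀ i j, IntegrableOn (fun t => iterConv κ k t i j) (Set.Ioi 0)) ∧
      (Matrix.of fun i j => ∫ t in Set.Ioi (0:ℝ), iterConv κ k t i j) = B ^ (k + 1)) ∧
    -- (ii)
    (∀ᵐ t ∂(volume.restrict (Set.Ioi (0:ℝ))), ∀ i j, Summable fun k => iterConv κ k t i j) ∧
    (∀ i j, IntegrableOn (fun t => ∑' k : ℕ, iterConv κ k t i j) (Set.Ioi 0)) ∧
    -- (iii)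
    IsUnit (1 - B) ∧
    (Matrix.of fun i j => ∫ t in Set.Ioi (0:ℝ), ∑' k : ℕ, iterConv κ k t i j)
      = (1 - B)⁻¹ * B ∧
    (∀ i j, HasSum (fun k : ℕ => (B ^ (k + 1)) i j) (((1 - B)⁻¹ * B) i j)) := by
  have hint := integrableOn_iterConv hκ_int
  have hmass (k : ℕ) : (Matrix.of fun i j => ∫ t in Ioi (0 : ℝ), iterConv κ k t i j) =
      B ^ (k + 1) := hB ▸ integral_iterConv hκ_int k
  have hmass' (k : ℕ) (i j : Fin K) :
      ∫ t in Ioi (0 : ℝ), iterConv κ k t i j = (B ^ (k + 1)) i j := congrFun₂ (hmass k) i j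
  have hpow := Matrix.summable_pow_of_spectralRadius_lt_one hρ
  have hinv : (1 - B)⁻¹ = ∑' k : ℕ, B ^ k := Matrix.inv_eq_left_inv hpow.tsum_pow_mul_one_sub
  have hsum (i j : Fin K) :
      HasSum (fun k : ℕ => (B ^ (k + 1)) i j) (((1 - B)⁻¹ * B) i j) := by
    have h : HasSum (fun k : ℕ => B ^ (k + 1)) ((1 - B)⁻¹ * B) := by
      simpa only [hinv, pow_succ] using hpow.hasSum.mul_right B
    exact Pi.hasSum.1 (Pi.hasSum.1 h i) j
  have hnorm (i j : Fin K) :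
      Summable fun k => ∫ t in Ioi (0 : ℝ), ‖iterConv κ k t i j‖ := by
    refine (hsum i j).summable.congr fun k => ?_
    rw [← hmass' k i j]
    refine setIntegral_congr_fun measurableSet_Ioi fun t ht => ?_
    exact (Real.norm_of_nonneg (iterConv_nonneg hκ_nonneg k t (le_of_lt ht) i j)).symm
  refine ⟨fun k => ⟨hint k, hmass k⟩, ?_, fun i j => ?_, ?_, ?_, hsum⟩
  · exact ae_all_iff.2 fun i => ae_all_iff.2 fun j =>
      ae_summable_of_summable_integral_norm (fun k => hint k i j) (hnorm i j)
  · exact integrable_tsum_of_summable_integral_norm (fun k => hint k i j) (hnorm i j)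
  · exact ⟨⟨1 - B, _, hpow.one_sub_mul_tsum_pow, hpow.tsum_pow_mul_one_sub⟩, rfl⟩
  · ext i j
    have h := hasSum_integral_of_summable_integral_norm (fun k => hint k i j) (hnorm i j)
    simp only [hmass'] at h
    exact h.unique (hsum i j)

end
end

section
/- Let (X_n(ν))_{n∈ℕ, ν∈A} be a family of random variables defined on a common probability space, with values in a normed space (E, ‖·‖), indexed by n ∈ ℕ and by ν in a compact set A ⊆ ℝ^d. Assume: (i) for every ν ∈ A, the sequence (X_n(ν))_n is bounded in probability, i.e. for every ε > 0 there exists M > 0 with limsup_n P(‖X_n(ν)‖ > M) ≤ ε; (ii) stochastic equicontinuity: for every η > 0 and ε > 0 there exists δ > 0 such that limsup_n P( sup_{ν₁,ν₂ ∈ A, ‖ν₁−ν₂‖ < δ} ‖X_n(ν₁) − X_n(ν₂)‖ > η ) ≤ ε; and (iii) for each n the suprema appearing in (ii) and in the conclusion are measurable. Then sup_{ν ∈ A} ‖X_n(ν)‖ is bounded in probability: for every ε > 0 there exists M > 0 with limsup_n P( sup_{ν∈A} ‖X_n(ν)‖ > M ) ≤ ε. -/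
open MeasureTheory Filter

/-- Strict eventual bounds follow from a bound on the limsup by a smaller constant. -/
theorem eventually_lt_ofReal_of_limsup_le {ι : Type*} {l : Filter ι} {u : ι → ENNReal} {a b : ℝ}
    (hu : limsup u l ≤ ENNReal.ofReal a) (hab : a < b) (hb : 0 < b) :
    ∀ᶠ i in l, u i < ENNReal.ofReal b :=
  eventually_lt_of_limsup_lt (hu.trans_lt ((ENNReal.ofReal_lt_ofReal_iff hb).2 hab))

/-- **From pointwise to uniform boundedness in probability.**
If a family of `E`-valued random variables indexed by `n ∈ ℕ` and by `ν` in a compact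
set `A ⊆ ℝ^d` is (i) bounded in probability pointwise in `ν`, and (ii) stochastically
equicontinuous in `ν` (with (iii) the relevant events measurable), then the supremum of
`‖X n ν‖` over `ν ∈ A` is bounded in probability. -/
theorem pointwise_to_uniform_bounded_in_probability
    {Ω : Type*} [MeasurableSpace Ω] (P : Measure Ω) [IsProbabilityMeasure P]
    {E : Type*} [NormedAddCommGroup E]
    {d : ℕ} (A : Set (Fin d → ℝ)) (hA : IsCompact A)
    (X : ℕ → (Fin d → ℝ) → Ω → E)
    -- (iii) measurability of the events appearing in (ii) and in the conclusion
    (hmeas_sup : ∀ (n : ℕ) (M : ℝ), MeasurableSet {ω | ∃ ν ∈ A, M < ‖X n ν ω‖})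
    (hmeas_osc : ∀ (n : ℕ) (δ η : ℝ), MeasurableSet
      {ω | ∃ ν₁ ∈ A, ∃ ν₂ ∈ A, ‖ν₁ - ν₂‖ < δ ∧ η < ‖X n ν₁ ω - X n ν₂ ω‖})
    -- (i) pointwise boundedness in probability
    (hpt : ∀ ν ∈ A, ∀ ε : ℝ, 0 < ε → ∃ M : ℝ, 0 < M ∧
      limsup (fun n => P {ω | M < ‖X n ν ω‖}) atTop ≤ ENNReal.ofReal ε)
    -- (ii) stochastic equicontinuity
    (heq : ∀ η ε : ℝ, 0 < η → 0 < ε → ∃ δ : ℝ, 0 < δ ∧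
      limsup
        (fun n => P {ω | ∃ ν₁ ∈ A, ∃ ν₂ ∈ A, ‖ν₁ - ν₂‖ < δ ∧ η < ‖X n ν₁ ω - X n ν₂ ω‖})
        atTop ≤ ENNReal.ofReal ε) :
    ∀ ε : ℝ, 0 < ε → ∃ M : ℝ, 0 < M ∧
      limsup (fun n => P {ω | ∃ ν ∈ A, M < ‖X n ν ω‖}) atTop ≤ ENNReal.ofReal ε := by
  intro ε hε
  obtain ⟨δ, hδ, hosc⟩ := heq 1 (ε / 4) one_pos (by positivity)
  obtain ⟨t, htA, htfin, hcover⟩ := hA.finite_cover_balls hδ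
  lift t to Finset (Fin d → ℝ) using htfin
  set c : ℝ := ε / (2 * (t.card + 1)) with hc
  have hc0 : 0 < c := by positivity
  have hpoint : ∀ ν ∈ t, ∀ᶠ M : ℝ in atTop,
      ∀ᶠ n in atTop, P {ω | M < ‖X n ν ω‖} < ENNReal.ofReal c := by
    intro ν hν
    obtain ⟨M, -, hM⟩ := hpt ν (htA hν) (c / 2) (by positivity)
    filter_upwards [eventually_ge_atTop M] with M' hMM'
    filter_upwards [eventually_lt_ofReal_of_limsup_le hM (half_lt_self hc0) hc0] with n hn
    exact (measure_mono fun ω (hω : M' < _) => hMM'.trans_lt hω).trans_lt hn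
  obtain ⟨M, hM, hM0⟩ :=
    (((Finset.eventually_all t).2 hpoint).and (eventually_gt_atTop (0 : ℝ))).exists
  refine ⟨M + 1, by positivity, limsup_le_of_le (by isBoundedDefault) ?_⟩
  filter_upwards [(Finset.eventually_all t).2 hM,
    eventually_lt_ofReal_of_limsup_le hosc (show ε / 4 < ε / 2 by linarith) (by positivity)]
    with n hn hoscn
  have hsub : {ω | ∃ ν ∈ A, M + 1 < ‖X n ν ω‖} ⊆
      {ω | ∃ ν₁ ∈ A, ∃ ν₂ ∈ A, ‖ν₁ - ν₂‖ < δ ∧ 1 < ‖X n ν₁ ω - X n ν₂ ω‖} ∪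
        ⋃ ν ∈ t, {ω | M < ‖X n ν ω‖} := by
    rintro ω ⟨ν, hν, hω⟩
    obtain ⟨ν', hν', hdist⟩ := Set.mem_iUnion₂.1 (hcover hν)
    rw [Metric.mem_ball, dist_eq_norm] at hdist
    by_cases h : 1 < ‖X n ν ω - X n ν' ω‖
    · exact Or.inl ⟨ν, hν, ν', htA hν', hdist, h⟩
    · refine Or.inr (Set.mem_iUnion₂.2 ⟨ν', hν', ?_⟩)
      have := norm_sub_norm_le (X n ν ω) (X n ν' ω)
      show M < ‖X n ν' ω‖
      linarith
  calc P {ω | ∃ ν ∈ A, M + 1 < ‖X n ν ω‖}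
      ≤ P {ω | ∃ ν₁ ∈ A, ∃ ν₂ ∈ A, ‖ν₁ - ν₂‖ < δ ∧ 1 < ‖X n ν₁ ω - X n ν₂ ω‖} +
          ∑ ν ∈ t, P {ω | M < ‖X n ν ω‖} :=
        (measure_mono hsub).trans <| (measure_union_le _ _).trans <| by
          gcongr
          exact measure_biUnion_finset_le t _
    _ ≤ ENNReal.ofReal (ε / 2) + ∑ _ν ∈ t, ENNReal.ofReal c := by
        gcongr with ν hν
        exact (hn ν hν).le
    _ = ENNReal.ofReal (ε / 2 + t.card * c) := by
        rw [Finset.sum_const, ENNReal.ofReal_add (by positivity) (by positivity),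
          ← nsmul_eq_mul, ENNReal.ofReal_nsmul]
    _ ≤ ENNReal.ofReal ε := by
        have hcard : (t.card + 1) * c = ε / 2 := by
          rw [hc]
          field_simp
        exact ENNReal.ofReal_le_ofReal (by linarith)
end

section
/- Let (X_n(ν))_{n∈ℕ, ν∈A} be a family of random variables defined on a common probability space, with values in a normed space (E, ‖·‖), indexed by n ∈ ℕ and by ν in a compact set A ⊆ ℝ^d. Assume: (i) for every ν ∈ A, X_n(ν) converges to 0 in probability as n → ∞, i.e. for every η > 0, P(‖X_n(ν)‖ > η) → 0; (ii) stochastic equicontinuity: for every η > 0 and ε > 0 there exists δ > 0 such that limsup_n P( sup_{ν₁,ν₂ ∈ A, ‖ν₁−ν₂‖ < δ} ‖X_n(ν₁) − X_n(ν₂)‖ > η ) ≤ ε; and (iii) for each n the suprema appearing in (ii) and in the conclusion are measurable. Then sup_{ν ∈ A} ‖X_n(ν)‖ converges to 0 in probability as n → ∞. -/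
open MeasureTheory Filter Topology

/-- **From pointwise to uniform convergence to zero in probability.**
If a family of `E`-valued random variables indexed by `n ∈ ℕ` and by `ν` in a compact
set `A ⊆ ℝ^d` (i) converges to `0` in probability pointwise in `ν`, and (ii) is
stochastically equicontinuous in `ν` (with (iii) the relevant events measurable), then
the supremum of `‖X n ν‖` over `ν ∈ A` converges to `0` in probability. -/
theorem pointwise_to_uniform_convergence_in_probability
    {Ω : Type*} [MeasurableSpace Ω] (P : Measure Ω) [IsProbabilityMeasure P]
    {E : Type*} [NormedAddCommGroup E]
    {d : ℕ} (A : Set (Fin d → ℝ)) (hA : IsCompact A)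
    (X : ℕ → (Fin d → ℝ) → Ω → E)
    -- (iii) measurability of the events appearing in (ii) and in the conclusion
    (hmeas_sup : ∀ (n : ℕ) (η : ℝ), MeasurableSet {ω | ∃ ν ∈ A, η < ‖X n ν ω‖})
    (hmeas_osc : ∀ (n : ℕ) (δ η : ℝ), MeasurableSet
      {ω | ∃ ν₁ ∈ A, ∃ ν₂ ∈ A, ‖ν₁ - ν₂‖ < δ ∧ η < ‖X n ν₁ ω - X n ν₂ ω‖})
    -- (i) pointwise convergence to zero in probability
    (hpt : ∀ ν ∈ A, ∀ η : ℝ, 0 < η →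
      Tendsto (fun n => P {ω | η < ‖X n ν ω‖}) atTop (𝓝 0))
    -- (ii) stochastic equicontinuity
    (heq : ∀ η ε : ℝ, 0 < η → 0 < ε → ∃ δ : ℝ, 0 < δ ∧
      limsup
        (fun n => P {ω | ∃ ν₁ ∈ A, ∃ ν₂ ∈ A, ‖ν₁ - ν₂‖ < δ ∧ η < ‖X n ν₁ ω - X n ν₂ ω‖})
        atTop ≤ ENNReal.ofReal ε) :
    ∀ η : ℝ, 0 < η →
      Tendsto (fun n => P {ω | ∃ ν ∈ A, η < ‖X n ν ω‖}) atTop (𝓝 0) := by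
  intro η hη
  rw [ENNReal.tendsto_nhds_zero]
  intro ε hε
  have hε2 : 0 < ε / 2 := ENNReal.half_pos hε.ne'
  obtain ⟨r, hr0, hr⟩ := ENNReal.lt_iff_exists_nnreal_btwn.1 hε2
  obtain ⟨δ, hδ, hlim⟩ := heq (η / 2) r (half_pos hη) (by exact_mod_cast hr0)
  rw [ENNReal.ofReal_coe_nnreal] at hlim
  have hosc := eventually_lt_of_limsup_lt (hlim.trans_lt hr)
  obtain ⟨t, htA, htfin, hcover⟩ := hA.finite_cover_balls hδ
  have hsum : Tendsto (fun n => ∑ ν ∈ htfin.toFinset, P {ω | η / 2 < ‖X n ν ω‖})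
      atTop (𝓝 0) := by
    simpa using tendsto_finsetSum htfin.toFinset fun ν hν =>
      hpt ν (htA (htfin.mem_toFinset.1 hν)) (η / 2) (half_pos hη)
  filter_upwards [hosc, ENNReal.tendsto_nhds_zero.1 hsum (ε / 2) hε2] with n hn hn'
  have hsub : {ω | ∃ ν ∈ A, η < ‖X n ν ω‖} ⊆
      {ω | ∃ ν₁ ∈ A, ∃ ν₂ ∈ A, ‖ν₁ - ν₂‖ < δ ∧ η / 2 < ‖X n ν₁ ω - X n ν₂ ω‖} ∪
        ⋃ ν ∈ htfin.toFinset, {ω | η / 2 < ‖X n ν ω‖} := by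
    rintro ω ⟨ν, hν, hω⟩
    obtain ⟨c, hc, hνc⟩ := Set.mem_iUnion₂.1 (hcover hν)
    rw [mem_ball_iff_norm] at hνc
    by_cases h : η / 2 < ‖X n c ω‖
    · exact Or.inr (Set.mem_iUnion₂.2 ⟨c, htfin.mem_toFinset.2 hc, h⟩)
    · refine Or.inl ⟨ν, hν, c, htA hc, hνc, ?_⟩
      linarith [norm_sub_norm_le (X n ν ω) (X n c ω)]
  calc P {ω | ∃ ν ∈ A, η < ‖X n ν ω‖}
      ≤ _ := measure_mono hsub
    _ ≤ _ := measure_union_le _ _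
    _ ≤ ε / 2 + ε / 2 :=
        add_le_add hn.le ((measure_biUnion_finset_le _ _).trans hn')
    _ = ε := ENNReal.add_halves ε
end

section
/- Let d ≥ 1, let 𝒜 ∈ M_d(ℝ) be symmetric positive definite, let x ∈ ℝ^d, and let z̃ be the (unique) minimizer over the closed orthant C = {z ∈ ℝ^d : z_i ≥ 0 for all i} of the quadratic form z ↦ (x − z)ᵀ 𝒜 (x − z). Let I ⊆ {1,…,d} with complement J, and set Y = ((𝒜⁻¹)_{I,I})⁻¹ x_I and Z = x_J − (𝒜⁻¹)_{J,I} Y. If Y has all coordinates strictly negative and Z has all coordinates strictly positive, then z̃ satisfies z̃_i = 0 for all i ∈ I and z̃_J = Z (so z̃_j > 0 for all j ∈ J), and the minimum value equals x_Iᵀ ((𝒜⁻¹)_{I,I})⁻¹ x_I. Conversely, if z̃_i = 0 for all i ∈ I and z̃_j > 0 for all j ∈ J, then Y has all coordinates nonpositive and z̃_J = Z. -/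
open Matrix

section Auxiliary

variable {n : Type*} [Fintype n]

/-- Expansion of a symmetric quadratic form at a difference. -/
lemma Matrix.IsSymm.quadForm_sub {A : Matrix n n ℝ} (hA : A.IsSymm) (w u : n → ℝ) :
    (w - u) ⬝ᵥ (A *ᵥ (w - u)) = w ⬝ᵥ (A *ᵥ w) - 2 * (u ⬝ᵥ (A *ᵥ w)) + u ⬝ᵥ (A *ᵥ u) := by
  have h : w ⬝ᵥ (A *ᵥ u) = u ⬝ᵥ (A *ᵥ w) := by
    rw [dotProduct_mulVec, ← mulVec_transpose, hA.eq, dotProduct_comm]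
  simp only [mulVec_sub, sub_dotProduct, dotProduct_sub, h]
  ring

/-- A dot product with a vector supported on `I` only sees the coordinates in `I`. -/
lemma dotProduct_eq_dotProduct_restrict (I : Finset n) (u v : n → ℝ) (hv : ∀ i ∉ I, v i = 0) :
    u ⬝ᵥ v = (fun i : {i // i ∈ I} => u i) ⬝ᵥ (fun i : {i // i ∈ I} => v i) := by
  simp only [dotProduct]
  rw [Finset.sum_coe_sort I fun i => u i * v i]
  exact (Finset.sum_subset (Finset.subset_univ I) fun i _ hi => by simp [hv i hi]).symm

/-- First-order conditions at a minimizer of a quadratic form over the orthant, along a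
coordinate direction. -/
lemma orthant_minimizer_coordinate_ineq {A : Matrix n n ℝ} [DecidableEq n] (hA : A.IsSymm)
    {x z₀ : n → ℝ} (hz₀ : ∀ i, 0 ≤ z₀ i)
    (hmin : ∀ z : n → ℝ, (∀ i, 0 ≤ z i) →
      (x - z₀) ⬝ᵥ (A *ᵥ (x - z₀)) ≤ (x - z) ⬝ᵥ (A *ᵥ (x - z)))
    (i : n) {t : ℝ} (ht : 0 ≤ z₀ i + t) :
    2 * t * (A *ᵥ (x - z₀)) i ≤ t ^ 2 * A i i := by
  have h := hmin (z₀ + Pi.single i t) fun j => by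
    rcases eq_or_ne j i with rfl | hj
    · simpa using ht
    · simpa [hj] using hz₀ j
  rw [← sub_sub, hA.quadForm_sub (x - z₀) (Pi.single i t)] at h
  simp only [single_dotProduct, mulVec_single, Pi.smul_apply, col_apply,
    MulOpposite.smul_eq_mul_unop, MulOpposite.unop_op] at h
  linarith

/-- The gradient of a quadratic form at a minimizer over the orthant has the right sign. -/
lemma orthant_minimizer_mulVec_nonpos {A : Matrix n n ℝ} [DecidableEq n] (hA : A.IsSymm)
    {x z₀ : n → ℝ} (hz₀ : ∀ i, 0 ≤ z₀ i)
    (hmin : ∀ z : n → ℝ, (∀ i, 0 ≤ z i) →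
      (x - z₀) ⬝ᵥ (A *ᵥ (x - z₀)) ≤ (x - z) ⬝ᵥ (A *ᵥ (x - z))) (i : n) :
    (A *ᵥ (x - z₀)) i ≤ 0 := by
  by_contra! he
  set e := (A *ᵥ (x - z₀)) i
  have hc : 0 < |A i i| + 1 := by positivity
  have ht : 0 < e / (|A i i| + 1) := by positivity
  have h := orthant_minimizer_coordinate_ineq hA hz₀ hmin i (add_nonneg (hz₀ i) ht.le)
  have hte : e / (|A i i| + 1) * (|A i i| + 1) = e := div_mul_cancel₀ _ hc.ne'
  generalize e / (|A i i| + 1) = t at *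
  have h' : 2 * e ≤ t * A i i := by
    refine le_of_mul_le_mul_left ?_ ht
    linarith
  nlinarith [le_abs_self (A i i)]

/-- Complementary slackness at a minimizer of a quadratic form over the orthant. -/
lemma orthant_minimizer_mulVec_eq_zero {A : Matrix n n ℝ} [DecidableEq n] (hA : A.IsSymm)
    {x z₀ : n → ℝ} (hz₀ : ∀ i, 0 ≤ z₀ i)
    (hmin : ∀ z : n → ℝ, (∀ i, 0 ≤ z i) →
      (x - z₀) ⬝ᵥ (A *ᵥ (x - z₀)) ≤ (x - z) ⬝ᵥ (A *ᵥ (x - z))) {i : n} (hi : 0 < z₀ i) :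
    (A *ᵥ (x - z₀)) i = 0 := by
  refine (orthant_minimizer_mulVec_nonpos hA hz₀ hmin i).antisymm ?_
  by_contra! he
  set e := (A *ᵥ (x - z₀)) i
  have hc : 0 < |A i i| + 1 := by positivity
  obtain ⟨t, ht, htz, hte⟩ : ∃ t, 0 < t ∧ t ≤ z₀ i ∧ t * (|A i i| + 1) ≤ -e :=
    ⟨min (z₀ i) (-e / (|A i i| + 1)), lt_min hi (div_pos (neg_pos.2 he) hc), min_le_left _ _,
      (le_div_iff₀ hc).1 (min_le_right _ _)⟩
  have h := orthant_minimizer_coordinate_ineq hA hz₀ hmin i (t := -t) (by linarith)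
  have h' : -(2 * e) ≤ t * A i i := by
    refine le_of_mul_le_mul_left ?_ ht
    linarith
  nlinarith [le_abs_self (A i i)]

/-- A feasible point satisfying the KKT conditions is the only minimizer of a positive definite
quadratic form over the orthant. -/
lemma orthant_minimizer_eq_of_kkt {A : Matrix n n ℝ} (hA : A.PosDef) (hs : A.IsSymm)
    {x z₀ z₁ : n → ℝ} (hz₀ : ∀ i, 0 ≤ z₀ i)
    (hle : (x - z₀) ⬝ᵥ (A *ᵥ (x - z₀)) ≤ (x - z₁) ⬝ᵥ (A *ᵥ (x - z₁)))
    (hgrad : ∀ i, (A *ᵥ (x - z₁)) i ≤ 0) (hslack : z₁ ⬝ᵥ (A *ᵥ (x - z₁)) = 0) :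
    z₀ = z₁ := by
  by_contra hne
  have hpos := hA.dotProduct_mulVec_pos (sub_ne_zero.2 hne)
  rw [star_trivial] at hpos
  have hu : (z₀ - z₁) ⬝ᵥ (A *ᵥ (x - z₁)) ≤ 0 := by
    rw [sub_dotProduct, hslack, sub_zero]
    exact Finset.sum_nonpos fun i _ => mul_nonpos_of_nonneg_of_nonpos (hz₀ i) (hgrad i)
  have hexp := hs.quadForm_sub (x - z₁) (z₀ - z₁)
  rw [sub_sub_sub_cancel_right] at hexp
  linarith

end Auxiliary

/-- **KKT characterization of the projection onto the nonnegative orthant.**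
Let `zt` minimize `z ↦ (x - z)ᵀ 𝒜 (x - z)` over the closed orthant `C = {z : z ≥ 0}`,
let `I` be a set of indices with complement `J`, and set `Y = ((𝒜⁻¹)_{I,I})⁻¹ x_I` and
`Z = x_J - (𝒜⁻¹)_{J,I} Y`.  If `Y < 0` and `Z > 0` coordinate-wise then `zt` vanishes
exactly on `I`, `zt_J = Z`, and the minimum value is `x_Iᵀ ((𝒜⁻¹)_{I,I})⁻¹ x_I`.
Conversely, if `zt_I = 0` and `zt_J > 0` coordinate-wise, then `Y ≤ 0` and `zt_J = Z`. -/
theorem kkt_orthant_projection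
    {d : ℕ} (hd : 1 ≤ d)
    (𝒜 : Matrix (Fin d) (Fin d) ℝ) (h𝒜 : 𝒜.PosDef) (h𝒜s : 𝒜.IsSymm)
    (x : Fin d → ℝ) (zt : Fin d → ℝ)
    (hztmem : ∀ i, 0 ≤ zt i)
    (hztmin : ∀ z : Fin d → ℝ, (∀ i, 0 ≤ z i) →
      (x - zt) ⬝ᵥ (𝒜 *ᵥ (x - zt)) ≤ (x - z) ⬝ᵥ (𝒜 *ᵥ (x - z)))
    (I : Finset (Fin d))
    (Y : {i // i ∈ I} → ℝ)
    (hY : Y = (((𝒜⁻¹).submatrix (fun i : {i // i ∈ I} => (i : Fin d))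
        (fun i : {i // i ∈ I} => (i : Fin d)))⁻¹) *ᵥ (fun i : {i // i ∈ I} => x i))
    (Z : {j // j ∈ Iᶜ} → ℝ)
    (hZ : Z = (fun j : {j // j ∈ Iᶜ} => x j) -
      ((𝒜⁻¹).submatrix (fun j : {j // j ∈ Iᶜ} => (j : Fin d))
        (fun i : {i // i ∈ I} => (i : Fin d))) *ᵥ Y) :
    ((∀ i, Y i < 0) → (∀ j, 0 < Z j) →
      (∀ i ∈ I, zt i = 0) ∧
      (∀ j : Fin d, ∀ hj : j ∈ Iᶜ, zt j = Z ⟨j, hj⟩) ∧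
      (x - zt) ⬝ᵥ (𝒜 *ᵥ (x - zt)) =
        (fun i : {i // i ∈ I} => x i) ⬝ᵥ
          ((((𝒜⁻¹).submatrix (fun i : {i // i ∈ I} => (i : Fin d))
              (fun i : {i // i ∈ I} => (i : Fin d)))⁻¹) *ᵥ
            (fun i : {i // i ∈ I} => x i))) ∧
    ((∀ i ∈ I, zt i = 0) → (∀ j ∈ Iᶜ, 0 < zt j) →
      (∀ i, Y i ≤ 0) ∧ (∀ j : Fin d, ∀ hj : j ∈ Iᶜ, zt j = Z ⟨j, hj⟩)) := by
  set S := (𝒜⁻¹).submatrix (fun i : {i // i ∈ I} => (i : Fin d))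
    (fun i : {i // i ∈ I} => (i : Fin d)) with hS
  have hdet : IsUnit 𝒜.det := (isUnit_iff_isUnit_det _).1 h𝒜.isUnit
  have hSdet : IsUnit S.det :=
    (isUnit_iff_isUnit_det _).1 (h𝒜.inv.submatrix Subtype.val_injective).isUnit
  constructor
  · intro hYneg hZpos
    let v : Fin d → ℝ := fun i => if h : i ∈ I then Y ⟨i, h⟩ else 0
    have hvY : (fun i : {i // i ∈ I} => v i) = Y := by
      ext i
      simp [v]
    have hvJ : ∀ i ∉ I, v i = 0 := fun i hi => by simp [v, hi]
    have hv : ∀ i, v i ≤ 0 := fun i => by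
      by_cases hi : i ∈ I
      · simpa [v, hi] using (hYneg ⟨i, hi⟩).le
      · exact (hvJ i hi).le
    have hinv : ∀ i, (𝒜⁻¹ *ᵥ v) i = (fun k : {k // k ∈ I} => 𝒜⁻¹ i k) ⬝ᵥ Y := fun i => by
      rw [mulVec, dotProduct_eq_dotProduct_restrict I _ v hvJ, hvY]
    have hSY : S *ᵥ Y = fun i : {i // i ∈ I} => x i := by
      rw [hY, mulVec_mulVec, mul_nonsing_inv _ hSdet, one_mulVec]
    obtain ⟨z, hz⟩ : ∃ z, z = x - 𝒜⁻¹ *ᵥ v := ⟨_, rfl⟩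
    have hzI : ∀ i ∈ I, z i = 0 := fun i hi => by
      rw [hz, Pi.sub_apply, hinv, sub_eq_zero]
      exact (congrFun hSY ⟨i, hi⟩).symm
    have hzJ : ∀ j, ∀ hj : j ∈ Iᶜ, z j = Z ⟨j, hj⟩ := fun j hj => by
      rw [hz, Pi.sub_apply, hinv, hZ]
      rfl
    have hz0 : ∀ i, 0 ≤ z i := fun i => by
      by_cases hi : i ∈ I
      · exact (hzI i hi).ge
      · rw [hzJ i (Finset.mem_compl.2 hi)]
        exact (hZpos _).le
    have hgrad : 𝒜 *ᵥ (x - z) = v := by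
      rw [hz, sub_sub_cancel, mulVec_mulVec, mul_nonsing_inv _ hdet, one_mulVec]
    have hslack : z ⬝ᵥ v = 0 := Finset.sum_eq_zero fun i _ => by
      by_cases hi : i ∈ I
      · rw [hzI i hi, zero_mul]
      · rw [hvJ i hi, mul_zero]
    obtain rfl : zt = z := orthant_minimizer_eq_of_kkt h𝒜 h𝒜s hztmem (hztmin z hz0)
      (by rwa [hgrad]) (by rwa [hgrad])
    refine ⟨hzI, hzJ, ?_⟩
    rw [hgrad, sub_dotProduct, hslack, sub_zero, dotProduct_eq_dotProduct_restrict I x v hvJ,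
      hvY, hY]
  · intro hzI hzJ
    obtain ⟨v, hv⟩ : ∃ v, v = 𝒜 *ᵥ (x - zt) := ⟨_, rfl⟩
    have hvJ : ∀ i ∉ I, v i = 0 := fun i hi => by
      rw [hv]
      exact orthant_minimizer_mulVec_eq_zero h𝒜s hztmem hztmin (hzJ i (Finset.mem_compl.2 hi))
    have hx : 𝒜⁻¹ *ᵥ v = x - zt := by
      rw [hv, mulVec_mulVec, nonsing_inv_mul _ hdet, one_mulVec]
    have hinv : ∀ i, (fun k : {k // k ∈ I} => 𝒜⁻¹ i k) ⬝ᵥ (fun k : {k // k ∈ I} => v k) =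
        x i - zt i := fun i => by
      rw [← dotProduct_eq_dotProduct_restrict I (𝒜⁻¹ i) v hvJ]
      exact congrFun hx i
    have hYv : Y = fun i : {i // i ∈ I} => v i := by
      have hSv : S *ᵥ (fun i : {i // i ∈ I} => v i) = fun i : {i // i ∈ I} => x i := by
        ext i
        refine (hinv i).trans ?_
        rw [hzI i i.2, sub_zero]
      rw [hY, ← hSv, mulVec_mulVec, nonsing_inv_mul _ hSdet, one_mulVec]
    refine ⟨fun i => ?_, fun j hj => ?_⟩
    · rw [hYv, hv]
      exact orthant_minimizer_mulVec_nonpos h𝒜s hztmem hztmin i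
    · rw [hZ, hYv]
      refine eq_sub_of_add_eq' ?_
      exact (congrArg (· + zt j) (hinv j)).trans (sub_add_cancel _ _)
end

section
/- Let X and Y be independent real random variables, each with the standard Gaussian law N(0,1). Then the law of the random variable (max(X, 0))² + (max(Y, 0))² is the mixture ¼·δ₀ + ½·χ²(1) + ¼·χ²(2), where δ₀ is the Dirac mass at 0 and χ²(k) is the chi-squared distribution with k degrees of freedom. -/
open MeasureTheory ProbabilityTheory
open scoped ENNReal

noncomputable section

/-- The chi-squared distribution with `k` degrees of freedom: the Gamma distribution with
shape `k/2` and rate `1/2`, with `χ²(0)` the Dirac mass at `0`. -/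
def chiSq (k : ℕ) : Measure ℝ :=
  if k = 0 then Measure.dirac 0 else gammaMeasure ((k : ℝ) / 2) (1 / 2)

lemma setLIntegral_Ioi_comp_sq (g : ℝ → ℝ≥0∞) :
    ∫⁻ x in Set.Ioi (0 : ℝ), ENNReal.ofReal (2 * x) * g (x ^ 2)
      = ∫⁻ u in Set.Ioi (0 : ℝ), g u := by
  have himage : (fun x : ℝ => x ^ 2) '' Set.Ioi 0 = Set.Ioi 0 := by
    ext u
    simp only [Set.mem_image, Set.mem_Ioi]
    constructor
    · rintro ⟨x, hx, rfl⟩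
      positivity
    · exact fun hu => ⟨√u, Real.sqrt_pos.2 hu, Real.sq_sqrt hu.le⟩
  have hderiv : ∀ x ∈ Set.Ioi (0 : ℝ),
      HasDerivWithinAt (fun x : ℝ => x ^ 2) (2 * x) (Set.Ioi 0) x := fun x _ => by
    simpa using (hasDerivAt_pow 2 x).hasDerivWithinAt
  have hmono : MonotoneOn (fun x : ℝ => x ^ 2) (Set.Ioi 0) := fun x hx y _ hxy =>
    pow_le_pow_left₀ (le_of_lt hx) hxy 2
  rw [← lintegral_image_eq_lintegral_deriv_mul_of_monotoneOn measurableSet_Ioi hderiv hmono g,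
    himage]

lemma lintegral_gammaMeasure (a r : ℝ) {f : ℝ → ℝ≥0∞} (hf : Measurable f) :
    ∫⁻ x, f x ∂gammaMeasure a r
      = ∫⁻ x in Set.Ioi (0 : ℝ),
          ENNReal.ofReal (r ^ a / Real.Gamma a * x ^ (a - 1) * Real.exp (-(r * x))) * f x := by
  have hpdf : Measurable (gammaPDF a r) := (measurable_gammaPDFReal a r).ennreal_ofReal
  rw [gammaMeasure, lintegral_withDensity_eq_lintegral_mul _ hpdf hf,
    ← lintegral_add_compl _ (measurableSet_Ici (a := (0 : ℝ))),
    setLIntegral_congr Ioi_ae_eq_Ici.symm, setLIntegral_congr_fun (g := fun _ => 0) measurableSet_Ici.compl]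
  · rw [lintegral_zero, add_zero]
    refine setLIntegral_congr_fun measurableSet_Ioi fun x hx => ?_
    simp only [Pi.mul_apply]
    rw [gammaPDF_of_nonneg (le_of_lt hx)]
  · intro x hx
    simp only [Set.compl_Ici, Set.mem_Iio] at hx
    simp [gammaPDF_of_neg hx]

lemma lintegral_comp_even_gaussianReal_zero (v : NNReal) (hv : v ≠ 0) {g : ℝ → ℝ≥0∞}
    (heven : ∀ x, g (-x) = g x) :
    ∫⁻ x, g x ∂gaussianReal 0 v = 2 * ∫⁻ x in Set.Ioi (0 : ℝ), g x ∂gaussianReal 0 v := by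
  have := nullSingletonClass_gaussianReal (μ := 0) hv
  have hneg : MeasurePreserving (fun x : ℝ => -x) (gaussianReal 0 v) (gaussianReal 0 v) :=
    ⟨measurable_neg, by rw [gaussianReal_map_neg, neg_zero]⟩
  have hhalf : ∫⁻ x in Set.Iio (0 : ℝ), g x ∂gaussianReal 0 v
      = ∫⁻ x in Set.Ioi (0 : ℝ), g x ∂gaussianReal 0 v := by
    rw [← hneg.setLIntegral_comp_preimage_emb (MeasurableEquiv.neg ℝ).measurableEmbedding]
    simp [heven]
  rw [← lintegral_add_compl _ (measurableSet_Ioi (a := (0 : ℝ))), Set.compl_Ioi,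
    setLIntegral_congr Iio_ae_eq_Iic.symm, hhalf, two_mul]

lemma lintegral_comp_sq_posPart_gaussianReal (v : NNReal) (hv : v ≠ 0) (f : ℝ → ℝ≥0∞) :
    ∫⁻ x, f ((max x 0) ^ 2) ∂gaussianReal 0 v
      = (1 / 2) * f 0 + (1 / 2) * ∫⁻ x, f (x ^ 2) ∂gaussianReal 0 v := by
  have := nullSingletonClass_gaussianReal (μ := 0) hv
  have htwo (c : ℝ≥0∞) : 1 / 2 * (2 * c) = c := by
    rw [← mul_assoc, ENNReal.div_mul_cancel (by simp) (by simp), one_mul]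
  have hIoi : gaussianReal 0 v (Set.Ioi 0) = 1 / 2 := by
    have h := lintegral_comp_even_gaussianReal_zero v hv (g := fun _ => 1) fun _ => rfl
    simp only [lintegral_const, measure_univ, Measure.restrict_apply_univ, one_mul] at h
    rw [← htwo (gaussianReal 0 v (Set.Ioi 0)), ← h, mul_one]
  have hIic : gaussianReal 0 v (Set.Iic 0) = 1 / 2 := by
    rw [← Set.compl_Ioi, prob_compl_eq_one_sub measurableSet_Ioi, hIoi]
    simp
  rw [lintegral_comp_even_gaussianReal_zero v hv (g := fun x => f (x ^ 2)) (by simp), htwo,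
    ← lintegral_add_compl _ (measurableSet_Iic (a := (0 : ℝ))), Set.compl_Iic]
  congr 1
  · rw [setLIntegral_congr_fun (g := fun _ => f 0) measurableSet_Iic, setLIntegral_const, hIic,
      mul_comm]
    intro x hx
    simp [max_eq_right (Set.mem_Iic.1 hx)]
  · refine setLIntegral_congr_fun measurableSet_Ioi fun x hx => ?_
    simp only [max_eq_left (Set.mem_Ioi.1 hx).le]

lemma lintegral_comp_sq_gaussianReal {f : ℝ → ℝ≥0∞} (hf : Measurable f) :
    ∫⁻ x, f (x ^ 2) ∂gaussianReal 0 1 = ∫⁻ u, f u ∂chiSq 1 := by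
  rw [chiSq, if_neg one_ne_zero, lintegral_gammaMeasure _ _ hf, ← setLIntegral_Ioi_comp_sq,
    lintegral_comp_even_gaussianReal_zero 1 one_ne_zero (g := fun x => f (x ^ 2)) (by simp),
    gaussianReal_of_var_ne_zero _ one_ne_zero,
    setLIntegral_withDensity_eq_setLIntegral_mul _ (measurable_gaussianPDF 0 1) (by fun_prop)
      measurableSet_Ioi,
    ← lintegral_const_mul _ (by fun_prop)]
  refine setLIntegral_congr_fun measurableSet_Ioi fun x hx => ?_
  have hx : 0 < x := hx
  simp only [Pi.mul_apply]
  rw [← mul_assoc, ← mul_assoc, gaussianPDF, ← ENNReal.ofReal_mul (by positivity),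
    ← ENNReal.ofReal_ofNat 2, ← ENNReal.ofReal_mul zero_le_two]
  congr 2
  have hpow : (x ^ 2) ^ ((((1 : ℕ) : ℝ) / 2) - 1) = x⁻¹ := by
    rw [← Real.rpow_natCast, ← Real.rpow_mul hx.le, ← Real.rpow_neg_one]
    norm_num
  have hhalf : (1 / 2 : ℝ) ^ (((1 : ℕ) : ℝ) / 2) = (√2)⁻¹ := by
    rw [Nat.cast_one, ← Real.sqrt_eq_rpow, one_div, Real.sqrt_inv]
  have hexp : -(x - 0) ^ 2 / (2 * ((1 : NNReal) : ℝ)) = -(1 / 2 * x ^ 2) := by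
    rw [NNReal.coe_one]
    ring
  rw [gaussianPDFReal, hpow, hhalf, hexp, Nat.cast_one, Real.Gamma_one_half_eq, NNReal.coe_one,
    mul_one, Real.sqrt_mul zero_le_two]
  field_simp

lemma lintegral_comp_sq_add_sq_gaussianReal {f : ℝ → ℝ≥0∞} (hf : Measurable f) :
    ∫⁻ x, ∫⁻ y, f (x ^ 2 + y ^ 2) ∂gaussianReal 0 1 ∂gaussianReal 0 1
      = ∫⁻ u, f u ∂chiSq 2 := by
  have hpdf := measurable_gaussianPDF 0 1
  have hdensity (x y : ℝ) : gaussianPDF 0 1 x * gaussianPDF 0 1 y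
      = ENNReal.ofReal ((2 * Real.pi)⁻¹ * Real.exp (-(1 / 2 * (x ^ 2 + y ^ 2)))) := by
    rw [gaussianPDF, gaussianPDF, ← ENNReal.ofReal_mul (gaussianPDFReal_nonneg _ _ _)]
    congr 1
    simp only [gaussianPDFReal, NNReal.coe_one, mul_one, sub_zero]
    rw [mul_mul_mul_comm, ← Real.exp_add, ← mul_inv, Real.mul_self_sqrt (by positivity)]
    congr 2
    ring
  have hplane : ∫⁻ x, ∫⁻ y, f (x ^ 2 + y ^ 2) ∂gaussianReal 0 1 ∂gaussianReal 0 1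
      = ∫⁻ p : ℝ × ℝ, ENNReal.ofReal
          ((2 * Real.pi)⁻¹ * Real.exp (-(1 / 2 * (p.1 ^ 2 + p.2 ^ 2)))) * f (p.1 ^ 2 + p.2 ^ 2) := by
    rw [gaussianReal_of_var_ne_zero _ one_ne_zero,
      lintegral_withDensity_eq_lintegral_mul _ hpdf
        (Measurable.lintegral_prod_right' (f := fun p : ℝ × ℝ => f (p.1 ^ 2 + p.2 ^ 2))
          (by fun_prop)),
      Measure.volume_eq_prod, lintegral_prod _ (by fun_prop)]
    refine lintegral_congr fun x => ?_
    rw [Pi.mul_apply, lintegral_withDensity_eq_lintegral_mul _ hpdf (by fun_prop),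
      ← lintegral_const_mul _ (by fun_prop)]
    refine lintegral_congr fun y => ?_
    rw [Pi.mul_apply, ← mul_assoc, hdensity]
  rw [hplane, ← lintegral_comp_polarCoord_symm, chiSq, if_neg two_ne_zero,
    lintegral_gammaMeasure _ _ hf, ← setLIntegral_Ioi_comp_sq, polarCoord_target,
    Measure.volume_eq_prod, ← Measure.prod_restrict, lintegral_prod]
  · refine setLIntegral_congr_fun measurableSet_Ioi fun r hr => ?_
    have hr : 0 < r := hr
    have hsq (θ : ℝ) : (r * Real.cos θ) ^ 2 + (r * Real.sin θ) ^ 2 = r ^ 2 := by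
      rw [mul_pow, mul_pow, ← mul_add, Real.cos_sq_add_sin_sq, mul_one]
    simp only [polarCoord_symm_apply, hsq, smul_eq_mul, lintegral_const,
      Measure.restrict_apply_univ, Real.volume_Ioo]
    rw [← mul_assoc, ← mul_assoc, mul_right_comm, ← ENNReal.ofReal_mul hr.le,
      ← ENNReal.ofReal_mul (by positivity), ← ENNReal.ofReal_mul (by positivity)]
    congr 2
    norm_num
    field_simp
    ring
  · simp only [polarCoord_symm_apply]
    fun_prop

/-- **Law of the sum of squared positive parts of two independent standard Gaussians.**
If `X, Y` are independent `N(0,1)` variables then `(max(X,0))² + (max(Y,0))²` has law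
`¼·δ₀ + ½·χ²(1) + ¼·χ²(2)`. -/
theorem sq_pos_parts_two_indep_gaussians_law
    {Ω : Type*} [MeasurableSpace Ω] (P : Measure Ω) [IsProbabilityMeasure P]
    (X Y : Ω → ℝ)
    (hX : Measure.map X P = gaussianReal 0 1)
    (hY : Measure.map Y P = gaussianReal 0 1)
    (hindep : IndepFun X Y P) :
    Measure.map (fun ω => (max (X ω) 0) ^ 2 + (max (Y ω) 0) ^ 2) P
      = (1 / 4 : ℝ≥0∞) • Measure.dirac (0 : ℝ) + (1 / 2 : ℝ≥0∞) • chiSq 1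
          + (1 / 4 : ℝ≥0∞) • chiSq 2 := by
  have hXm : AEMeasurable X P := AEMeasurable.of_map_ne_zero (by
    rw [hX]
    exact IsProbabilityMeasure.ne_zero _)
  have hYm : AEMeasurable Y P := AEMeasurable.of_map_ne_zero (by
    rw [hY]
    exact IsProbabilityMeasure.ne_zero _)
  have hjoint := (indepFun_iff_map_prod_eq_prod_map_map hXm hYm).1 hindep
  rw [hX, hY] at hjoint
  refine Measure.ext_of_lintegral _ fun f hf => ?_
  have hinner (a : ℝ) := lintegral_comp_sq_posPart_gaussianReal 1 one_ne_zero fun t => f (a + t)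
  have houter := lintegral_comp_sq_posPart_gaussianReal 1 one_ne_zero
    fun s => ∫⁻ y, f (s + (max y 0) ^ 2) ∂gaussianReal 0 1
  have hm : Measurable fun x : ℝ => ∫⁻ y, f (x ^ 2 + y ^ 2) ∂gaussianReal 0 1 :=
    Measurable.lintegral_prod_right' (f := fun p : ℝ × ℝ => f (p.1 ^ 2 + p.2 ^ 2)) (by fun_prop)
  have hquarter : (1 / 2 : ℝ≥0∞) * (1 / 2) = 1 / 4 := by
    rw [one_div, one_div, ← ENNReal.mul_inv (by simp) (by simp)]
    norm_num
  rw [lintegral_map' hf.aemeasurable (by fun_prop)]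
  have hlaw : ∫⁻ ω, f ((max (X ω) 0) ^ 2 + (max (Y ω) 0) ^ 2) ∂P
      = ∫⁻ x, ∫⁻ y, f ((max x 0) ^ 2 + (max y 0) ^ 2) ∂gaussianReal 0 1 ∂gaussianReal 0 1 := by
    rw [← lintegral_prod (fun p : ℝ × ℝ => f ((max p.1 0) ^ 2 + (max p.2 0) ^ 2)) (by fun_prop),
      ← hjoint, lintegral_map' (by fun_prop) (by fun_prop)]
  rw [hlaw, houter]
  simp only [hinner]
  simp only [zero_add, add_zero]
  rw [lintegral_add_left (by fun_prop), lintegral_const_mul _ (by fun_prop),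
    lintegral_const_mul _ hm, lintegral_comp_sq_gaussianReal hf,
    lintegral_comp_sq_add_sq_gaussianReal hf]
  simp only [lintegral_add_measure, lintegral_smul_measure, lintegral_dirac, smul_eq_mul]
  simp only [mul_add, ← mul_assoc, hquarter]
  have hhalf : (1 / 2 : ℝ≥0∞) = 1 / 4 + 1 / 4 := by
    rw [← hquarter, ← mul_add, ENNReal.add_halves, mul_one]
  rw [hhalf]
  ring

end
end
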